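/- arXiv:1809.04316 — 2 statements merged into one kernel-verified Lean document; each statement's English description precedes it below -/
import Mathlib

section
/- Let F be a number field, A a ℤ-order in F, O a proper A-order in a quaternion F-algebra D, and Ã := Nr_A(O). For any class [I] ∈ Cl(O), the stabilizer of [I] under the Pic(A)-action on Cl(O) is contained in the kernel of the homomorphism Sq: Pic(A) → Pic(Ã) given by [a] ↦ [aÃ]². -/
/-!
STATEMENT 4: Let `F` be a number field, `A` a `ℤ`-order in `F`, `O` a proper `A`-order in a
quaternion `F`-algebra `D = ℍ[F,c₁,c₂]`, and `Ã := Nr_A(O)` the suborder of `O_F` spanned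
over `A` by reduced norms of elements of `O`.  For any class `[I] ∈ Cl(O)`, the stabilizer
of `[I]` under the `Pic(A)`-action on `Cl(O)` is contained in the kernel of the
homomorphism `Sq : Pic(A) → Pic(Ã)`, `[a] ↦ [aÃ]²`.

This is stated pointwise: if `a` is an invertible (= locally principal) fractional
`A`-ideal and `I` a locally principal right `O`-ideal with `[a]·[I] = [I]` in `Cl(O)`
(i.e. `aI = λI` for some `λ ∈ Dˣ`), then `Sq([a]) = 1`, i.e. the extension of `a²` to `Ã`
is a principal fractional `Ã`-ideal.
-/

noncomputable section

section PicardConstruction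

open scoped Pointwise

variable {L : Type*} [CommRing L]

instance unitsCommGroup (A : Subalgebra ℤ L) : CommGroup (Submodule ↥A L)ˣ :=
  Units.instCommGroupUnits (α := Submodule ↥A L)

/-- The subgroup of principal invertible fractional ideals (those generated by a single
invertible element of `L`). -/
def principalSub (A : Subalgebra ℤ L) : Subgroup (Submodule ↥A L)ˣ where
  carrier := {u | ∃ x : L, IsUnit x ∧ (u : Submodule ↥A L) = Submodule.span ↥A {x}}
  one_mem' := ⟨1, isUnit_one, by simp [Submodule.one_eq_span]⟩
  mul_mem' := by
    rintro u v ⟨x, hx, hux⟩ ⟨y, hy, hvy⟩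
    exact ⟨x * y, hx.mul hy, by
      push_cast [hux, hvy]
      rw [Submodule.span_mul_span, Set.singleton_mul_singleton]⟩
  inv_mem' := by
    rintro u ⟨x, hx, hux⟩
    refine ⟨(hx.unit⁻¹ : Lˣ), Units.isUnit _, ?_⟩
    have h1 : (u : Submodule ↥A L) * Submodule.span ↥A {((hx.unit⁻¹ : Lˣ) : L)} = 1 := by
      rw [hux, Submodule.span_mul_span, Set.singleton_mul_singleton]
      simp [Submodule.one_eq_span]
    calc ((u⁻¹ : (Submodule ↥A L)ˣ) : Submodule ↥A L)
        = (u⁻¹ : (Submodule ↥A L)ˣ) * ((u : Submodule ↥A L) *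
            Submodule.span ↥A {((hx.unit⁻¹ : Lˣ) : L)}) := by
            rw [h1]; exact (mul_one ((u⁻¹ : (Submodule ↥A L)ˣ) : Submodule ↥A L)).symm
      _ = Submodule.span ↥A {((hx.unit⁻¹ : Lˣ) : L)} := by
            rw [← mul_assoc, ← Units.val_mul, inv_mul_cancel, Units.val_one]
            exact one_mul (Submodule.span ↥A {((hx.unit⁻¹ : Lˣ) : L)})

/-- The Picard group of a `ℤ`-order `A` realized inside `L`: invertible (equivalently,
locally principal) fractional `A`-ideals modulo principal fractional `A`-ideals. -/
def Picard (A : Subalgebra ℤ L) : Type _ := (Submodule ↥A L)ˣ ⧸ principalSub A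

noncomputable instance (A : Subalgebra ℤ L) : CommGroup (Picard A) :=
  QuotientGroup.Quotient.commGroup (principalSub A)

/-- The ideal class of an invertible fractional ideal in the Picard group. -/
def picCls (A : Subalgebra ℤ L) (u : (Submodule ↥A L)ˣ) : Picard A := QuotientGroup.mk u

/-- The class number `h(A) = |Pic(A)|` of a `ℤ`-order `A` realized in `L`. -/
noncomputable def hPic (A : Subalgebra ℤ L) : ℕ := Nat.card (Picard A)

end PicardConstruction
open scoped Quaternion Pointwise

/-- A `ℤ`-order in a `ℚ`-algebra `V`: a subring, finitely generated as a `ℤ`-module,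
containing a `ℚ`-basis of `V` (i.e. spanning `V` over `ℚ`). -/
def IsZOrder {V : Type*} [Ring V] [Algebra ℚ V] (O : Subalgebra ℤ V) : Prop :=
  (Subalgebra.toSubmodule O).FG ∧ Submodule.span ℚ (O : Set V) = ⊤

variable {F : Type*} [Field F] [NumberField F] {c₁ c₂ : F}

/-- The reduced norm on the quaternion algebra `ℍ[F, c₁, c₂]`. -/
def quatNrd (x : ℍ[F, c₁, c₂]) : F :=
  x.re * x.re - c₁ * x.imI * x.imI - c₂ * x.imJ * x.imJ + c₁ * c₂ * x.imK * x.imK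

/-- `O` is a proper `A`-order in the quaternion algebra `D = ℍ[F,c₁,c₂]`:
a `ℤ`-order of full rank in `D` with `O ∩ F = A`. -/
def IsProperOrder (A : Subalgebra ℤ F) (O : Subalgebra ℤ ℍ[F, c₁, c₂]) : Prop :=
  IsZOrder O ∧ ∀ x : F, algebraMap F ℍ[F, c₁, c₂] x ∈ O ↔ x ∈ A

/-- `Ã = Nr_A(O)`: the suborder of `O_F` spanned over `A` by the reduced norms of the
elements of `O` (equivalently, the subring generated by `A` and these reduced norms). -/
def normOrder (A : Subalgebra ℤ F) (O : Subalgebra ℤ ℍ[F, c₁, c₂]) : Subalgebra ℤ F :=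
  Algebra.adjoin ℤ ((A : Set F) ∪ (quatNrd '' (O : Set ℍ[F, c₁, c₂])))

/-- The localization at a prime `p` of a subset of a `ℤ`-module. -/
def locAt {V : Type*} [AddCommGroup V] (p : ℕ) (S : Set V) : Set V :=
  {x | ∃ n : ℤ, ¬ (p : ℤ) ∣ n ∧ n • x ∈ S}

/-- `I` is a locally principal right fractional `O`-ideal in `D = ℍ[F,c₁,c₂]`:
a full `ℤ`-lattice in `D`, stable under right multiplication by `O`, which at every
rational prime `p` is principal, generated by a unit `λ` of `D`. -/
def IsLocPrincRightIdeal (O : Subalgebra ℤ ℍ[F, c₁, c₂]) (I : Submodule ℤ ℍ[F, c₁, c₂]) :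
    Prop :=
  I.FG ∧ Submodule.span ℚ (I : Set ℍ[F, c₁, c₂]) = ⊤ ∧
    (∀ x ∈ I, ∀ r ∈ O, x * r ∈ I) ∧
    ∀ p : ℕ, p.Prime → ∃ lam : ℍ[F, c₁, c₂]ˣ,
      locAt p (I : Set ℍ[F, c₁, c₂]) = locAt p ((fun y => (lam : ℍ[F, c₁, c₂]) * y) '' O)

/-- Left multiplication `I ↦ λI` on right `O`-ideals. -/
def lmul (lam : ℍ[F, c₁, c₂]ˣ) (I : Submodule ℤ ℍ[F, c₁, c₂]) : Submodule ℤ ℍ[F, c₁, c₂] :=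
  I.map (LinearMap.mulLeft ℤ (lam : ℍ[F, c₁, c₂]))

/-- The product ideal `a·I` of a fractional `A`-ideal `a ⊆ F` and a right ideal `I ⊆ D`. -/
def idMul (A : Subalgebra ℤ F) (a : Submodule ↥A F) (I : Submodule ℤ ℍ[F, c₁, c₂]) :
    Submodule ℤ ℍ[F, c₁, c₂] :=
  Submodule.span ℤ {z | ∃ f ∈ a, ∃ y ∈ I, z = algebraMap F ℍ[F, c₁, c₂] f * y}

/-- The type of locally principal right `O`-ideals. -/
def LPIdeals (O : Subalgebra ℤ ℍ[F, c₁, c₂]) : Type _ :=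
  {I : Submodule ℤ ℍ[F, c₁, c₂] // IsLocPrincRightIdeal O I}

/-- The right ideal class set `Cl(O)`:  locally principal right `O`-ideals modulo the
equivalence `I ∼ J ↔ I = λJ` for some `λ ∈ Dˣ`. -/
def ClO (O : Subalgebra ℤ ℍ[F, c₁, c₂]) : Type _ :=
  Quot (fun I J : LPIdeals O => ∃ lam : ℍ[F, c₁, c₂]ˣ, I.1 = lmul lam J.1)

/-- The class number `h(O) = |Cl(O)|`. -/
noncomputable def hCl (O : Subalgebra ℤ ℍ[F, c₁, c₂]) : ℕ := Nat.card (ClO O)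

section ReducedNorm

variable {F : Type*} [Field F] {c₁ c₂ : F}

theorem quatNrd_mul (x y : ℍ[F, c₁, c₂]) : quatNrd (x * y) = quatNrd x * quatNrd y := by
  simp [quatNrd]; ring

theorem quatNrd_one : quatNrd (1 : ℍ[F, c₁, c₂]) = 1 := by
  simp [quatNrd]

theorem quatNrd_smul (f : F) (x : ℍ[F, c₁, c₂]) : quatNrd (f • x) = f * f * quatNrd x := by
  simp [quatNrd]; ring

theorem quatNrd_zsmul (n : ℤ) (x : ℍ[F, c₁, c₂]) :
    quatNrd (n • x) = (n * n : ℤ) • quatNrd x := by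
  simp [quatNrd]; ring

theorem quatNrd_unit_ne_zero (lam : ℍ[F, c₁, c₂]ˣ) : quatNrd (lam : ℍ[F, c₁, c₂]) ≠ 0 := by
  intro h
  have := quatNrd_mul (lam : ℍ[F, c₁, c₂]) ↑lam⁻¹
  simp [h, quatNrd_one] at this

theorem polar_quatNrd_smul_smul (f g : F) (x y : ℍ[F, c₁, c₂]) :
    QuadraticMap.polar quatNrd (f • x) (g • y) = f * g * QuadraticMap.polar quatNrd x y := by
  simp [quatNrd, QuadraticMap.polar]; ring

theorem polar_quatNrd_add_left (x y z : ℍ[F, c₁, c₂]) :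
    QuadraticMap.polar quatNrd (x + y) z =
      QuadraticMap.polar quatNrd x z + QuadraticMap.polar quatNrd y z := by
  simp [quatNrd, QuadraticMap.polar]; ring

theorem polar_quatNrd_zsmul_left (n : ℤ) (x y : ℍ[F, c₁, c₂]) :
    QuadraticMap.polar quatNrd (n • x) y = n • QuadraticMap.polar quatNrd x y := by
  simp [quatNrd, QuadraticMap.polar]; ring

/-- The reduced norm maps the `ℤ`-span of `S` into `P` as soon as it and its polar form do so
on `S`. -/
theorem quatNrd_mem_of_mem_span {S : Set ℍ[F, c₁, c₂]} {P : AddSubgroup F}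
    (hS : ∀ s ∈ S, quatNrd s ∈ P)
    (hSS : ∀ s ∈ S, ∀ t ∈ S, QuadraticMap.polar quatNrd s t ∈ P)
    {y : ℍ[F, c₁, c₂]} (hy : y ∈ Submodule.span ℤ S) : quatNrd y ∈ P := by
  have extend : ∀ t, (∀ s ∈ S, QuadraticMap.polar quatNrd s t ∈ P) →
      ∀ x ∈ Submodule.span ℤ S, QuadraticMap.polar quatNrd x t ∈ P := by
    intro t ht x hx
    induction hx using Submodule.span_induction with
    | mem x hx => exact ht x hx
    | zero => simp [QuadraticMap.polar, quatNrd]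
    | add x z _ _ hx hz => rw [polar_quatNrd_add_left]; exact P.add_mem hx hz
    | smul n x _ hx => rw [polar_quatNrd_zsmul_left]; exact P.zsmul_mem hx n
  have hpolar : ∀ x ∈ Submodule.span ℤ S, ∀ z ∈ Submodule.span ℤ S,
      QuadraticMap.polar quatNrd x z ∈ P := fun x hx z hz =>
    extend z (fun s hs => by
      rw [QuadraticMap.polar_comm]
      exact extend s (fun t ht => hSS t ht s hs) z hz) x hx
  induction hy using Submodule.span_induction with
  | mem x hx => exact hS x hx
  | zero => simp [quatNrd]
  | add x z hx hz ihx ihz =>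
    have : quatNrd (x + z) = quatNrd x + quatNrd z + QuadraticMap.polar quatNrd x z := by
      simp [QuadraticMap.polar]
    rw [this]
    exact P.add_mem (P.add_mem ihx ihz) (hpolar x hx z hz)
  | smul n x _ ihx => rw [quatNrd_zsmul]; exact P.zsmul_mem ihx _

end ReducedNorm

section NormModule

variable {F : Type*} [Field F] {c₁ c₂ : F}
  {A : Subalgebra ℤ F} {O : Subalgebra ℤ ℍ[F, c₁, c₂]}

theorem mem_normOrder_of_mem {x : F} (hx : x ∈ A) : x ∈ normOrder A O :=
  Algebra.subset_adjoin (Or.inl hx)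

theorem quatNrd_mem_normOrder {y : ℍ[F, c₁, c₂]} (hy : y ∈ O) : quatNrd y ∈ normOrder A O :=
  Algebra.subset_adjoin (Or.inr ⟨y, hy, rfl⟩)

variable (A O) in
/-- The `Nr_A(O)`-module generated by the reduced norms of the elements of `J`. -/
def normModule (J : Submodule ℤ ℍ[F, c₁, c₂]) : Submodule ↥(normOrder A O) F :=
  Submodule.span _ (quatNrd '' (J : Set ℍ[F, c₁, c₂]))

theorem quatNrd_mem_normModule {J : Submodule ℤ ℍ[F, c₁, c₂]} {y : ℍ[F, c₁, c₂]} (hy : y ∈ J) :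
    quatNrd y ∈ normModule A O J :=
  Submodule.subset_span ⟨y, hy, rfl⟩

theorem polar_mem_normModule {J : Submodule ℤ ℍ[F, c₁, c₂]} {x y : ℍ[F, c₁, c₂]}
    (hx : x ∈ J) (hy : y ∈ J) : QuadraticMap.polar quatNrd x y ∈ normModule A O J :=
  sub_mem (sub_mem (quatNrd_mem_normModule (J.add_mem hx hy)) (quatNrd_mem_normModule hx))
    (quatNrd_mem_normModule hy)

theorem mul_mem_normModule {J : Submodule ℤ ℍ[F, c₁, c₂]} {x z : F} (hx : x ∈ normOrder A O)
    (hz : z ∈ normModule A O J) : x * z ∈ normModule A O J :=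
  (normModule A O J).smul_mem ⟨x, hx⟩ hz

theorem normModule_mono {J K : Submodule ℤ ℍ[F, c₁, c₂]} (h : J ≤ K) :
    normModule A O J ≤ normModule A O K :=
  Submodule.span_mono (Set.image_mono h)

theorem mem_normModule_lmul_iff (lam : ℍ[F, c₁, c₂]ˣ) (J : Submodule ℤ ℍ[F, c₁, c₂]) (z : F) :
    z ∈ normModule A O (lmul lam J) ↔
      ∃ w ∈ normModule A O J, quatNrd (lam : ℍ[F, c₁, c₂]) * w = z := by
  have h : normModule A O (lmul lam J) = (normModule A O J).map
      (LinearMap.mulLeft (normOrder A O) (quatNrd (lam : ℍ[F, c₁, c₂]))) := by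
    rw [normModule, normModule, Submodule.map_span, ← Set.image_comp, lmul, Submodule.map_coe,
      ← Set.image_comp]
    congr 2
    funext y
    simp [quatNrd_mul]
  rw [h, Submodule.mem_map]
  rfl

theorem le_idMul_inv_idMul (u : (Submodule ↥A F)ˣ) (J : Submodule ℤ ℍ[F, c₁, c₂]) :
    J ≤ idMul A (↑u⁻¹ : Submodule ↥A F) (idMul A (u : Submodule ↥A F) J) := by
  intro y hy
  have key : ∀ c ∈ (↑u⁻¹ : Submodule ↥A F) * (u : Submodule ↥A F),
      c • y ∈ idMul A (↑u⁻¹ : Submodule ↥A F) (idMul A (u : Submodule ↥A F) J) := by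
    intro c hc
    induction hc using Submodule.mul_induction_on' with
    | mem_mul_mem g hg f hf =>
      exact Submodule.subset_span ⟨g, hg, f • y,
        Submodule.subset_span ⟨f, hf, y, hy, Algebra.smul_def _ _⟩, by
          rw [← Algebra.smul_def, smul_smul]⟩
    | add x _ z _ hx hz => rw [add_smul]; exact add_mem hx hz
  have := key 1 (by
    rw [Units.inv_mul]
    exact Submodule.one_le.mp le_rfl)
  simpa using this

theorem idMul_inv_idMul_le (u : (Submodule ↥A F)ˣ) (J : Submodule ℤ ℍ[F, c₁, c₂])
    (hJ : ∀ x ∈ A, ∀ y ∈ J, x • y ∈ J) :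
    idMul A (↑u⁻¹ : Submodule ↥A F) (idMul A (u : Submodule ↥A F) J) ≤ J := by
  refine Submodule.span_le.mpr ?_
  rintro _ ⟨g, hg, y, hy, rfl⟩
  rw [← Algebra.smul_def]
  change g • y ∈ J
  induction hy using Submodule.span_induction with
  | mem _ h =>
    obtain ⟨f, hf, y, hy, rfl⟩ := h
    rw [← Algebra.smul_def, smul_smul]
    have hgf : g * f ∈ (↑u⁻¹ : Submodule ↥A F) * (u : Submodule ↥A F) :=
      Submodule.mul_mem_mul hg hf
    rw [Units.inv_mul] at hgf
    obtain ⟨x, hx⟩ := Submodule.mem_one.mp hgf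
    rw [← hx]
    exact hJ _ x.2 y hy
  | zero => simp
  | add x z _ _ hx hz => rw [smul_add]; exact add_mem hx hz
  | smul n x _ hx => rw [smul_comm]; exact J.smul_mem n hx

/-- `u² Nr(J) ⊆ Nr(uJ)` for an invertible fractional ideal `u`. -/
theorem mul_mem_normModule_idMul (u : (Submodule ↥A F)ˣ) (J : Submodule ℤ ℍ[F, c₁, c₂])
    {w z : F} (hw : w ∈ (u : Submodule ↥A F) * (u : Submodule ↥A F))
    (hz : z ∈ normModule A O J) :
    w * z ∈ normModule A O (idMul A (u : Submodule ↥A F) J) := by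
  have hmul : ∀ g ∈ (↑u⁻¹ : Submodule ↥A F), ∀ h ∈ (↑u⁻¹ : Submodule ↥A F),
      w * (g * h) ∈ normOrder A O := by
    intro g hg h hh
    have hwgh := Submodule.mul_mem_mul hw (Submodule.mul_mem_mul hg hh)
    have h1 : (u : Submodule ↥A F) * u * (↑u⁻¹ * ↑u⁻¹) = 1 := by
      rw [mul_mul_mul_comm, Units.mul_inv, mul_one]
    rw [h1] at hwgh
    obtain ⟨x, hx⟩ := Submodule.mem_one.mp hwgh
    rw [← hx]
    exact mem_normOrder_of_mem x.2
  refine (Submodule.span_le (p := (normModule A O (idMul A (u : Submodule ↥A F) J)).comap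
    (LinearMap.mulLeft (normOrder A O) w))).mpr ?_ hz
  rintro _ ⟨y, hy, rfl⟩
  refine quatNrd_mem_of_mem_span (P := ((normModule A O (idMul A (u : Submodule ↥A F) J)).comap
    (LinearMap.mulLeft (normOrder A O) w)).toAddSubgroup) ?_ ?_ (le_idMul_inv_idMul u J hy)
  · rintro _ ⟨g, hg, y, hy, rfl⟩
    change w * _ ∈ normModule A O _
    rw [← Algebra.smul_def, quatNrd_smul, ← mul_assoc]
    exact mul_mem_normModule (hmul g hg g hg) (quatNrd_mem_normModule hy)
  · rintro _ ⟨g, hg, y, hy, rfl⟩ _ ⟨h, hh, x, hx, rfl⟩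
    change w * _ ∈ normModule A O _
    rw [← Algebra.smul_def, ← Algebra.smul_def, polar_quatNrd_smul_smul, ← mul_assoc]
    exact mul_mem_normModule (hmul g hg h hh) (polar_mem_normModule hy hx)

theorem exists_zsmul_eq_quatNrd_mul {I : Submodule ℤ ℍ[F, c₁, c₂]} {p : ℕ} (hp : p.Prime)
    {lam : ℍ[F, c₁, c₂]}
    (hlam : locAt p (I : Set ℍ[F, c₁, c₂]) = locAt p ((fun y => lam * y) '' O))
    {z : F} (hz : z ∈ normModule A O I) :
    ∃ n : ℤ, ¬ (p : ℤ) ∣ n ∧ ∃ t ∈ normOrder A O, n • z = quatNrd lam * t := by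
  have hp' : Prime (p : ℤ) := Nat.prime_iff_prime_int.mp hp
  induction hz using Submodule.span_induction with
  | mem _ h =>
    obtain ⟨y, hy, rfl⟩ := h
    have hloc : y ∈ locAt p (I : Set ℍ[F, c₁, c₂]) :=
      ⟨1, fun h => hp'.not_isUnit (isUnit_of_dvd_one h), by simpa using hy⟩
    rw [hlam] at hloc
    obtain ⟨k, hk, o, ho, hko⟩ := hloc
    refine ⟨k * k, hp'.not_dvd_mul hk hk, quatNrd o, quatNrd_mem_normOrder ho, ?_⟩
    rw [← quatNrd_zsmul, ← hko, quatNrd_mul]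
  | zero => exact ⟨1, fun h => hp'.not_isUnit (isUnit_of_dvd_one h), 0, zero_mem _, by simp⟩
  | add x y _ _ hx hy =>
    obtain ⟨n, hn, s, hs, hns⟩ := hx
    obtain ⟨m, hm, t, ht, hmt⟩ := hy
    refine ⟨n * m, hp'.not_dvd_mul hn hm, m • s + n • t,
      add_mem (zsmul_mem hs m) (zsmul_mem ht n), ?_⟩
    rw [mul_add, mul_smul_comm, mul_smul_comm, ← hns, ← hmt, smul_add, smul_smul, smul_smul,
      mul_comm n m]
  | smul r x _ hx =>
    obtain ⟨n, hn, s, hs, hns⟩ := hx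
    refine ⟨n, hn, r * s, mul_mem r.2 hs, ?_⟩
    rw [smul_comm, hns, Subalgebra.smul_def, smul_eq_mul, mul_left_comm]

/-- The multiplier ring of `Nr(I)` is `Nr_A(O)`. -/
theorem mem_normOrder_of_forall_mul_mem [NumberField F] {I : Submodule ℤ ℍ[F, c₁, c₂]}
    (hI : IsLocPrincRightIdeal O I) {x : F}
    (hx : ∀ z ∈ normModule A O I, x * z ∈ normModule A O I) : x ∈ normOrder A O := by
  let D : Ideal ℤ :=
    (Subalgebra.toSubmodule (normOrder A O)).comap (LinearMap.toSpanSingleton ℤ F x)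
  have hD : ∀ n : ℤ, n ∈ D ↔ n • x ∈ normOrder A O := fun _ => Iff.rfl
  suffices h : D = ⊤ by simpa using (hD 1).mp (h ▸ Submodule.mem_top)
  by_contra hne
  obtain ⟨p, hp, hpD⟩ : ∃ p : ℕ, p.Prime ∧ ∀ n ∈ D, (p : ℤ) ∣ n := by
    obtain ⟨d, hd⟩ := IsPrincipalIdealRing.principal D
    have hd1 : d.natAbs ≠ 1 := fun h => hne (by
      rw [hd]; exact Ideal.span_singleton_eq_top.mpr (Int.isUnit_iff_natAbs_eq.mpr h))
    obtain ⟨p, hp, hpd⟩ := Nat.exists_prime_and_dvd hd1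
    refine ⟨p, hp, fun n hn => (Int.natCast_dvd.mpr hpd).trans ?_⟩
    rw [hd] at hn
    exact Ideal.mem_span_singleton.mp hn
  have hp' : Prime (p : ℤ) := Nat.prime_iff_prime_int.mp hp
  obtain ⟨lam, hlam⟩ := hI.2.2.2 p hp
  obtain ⟨m, hm, hmI⟩ : (lam : ℍ[F, c₁, c₂]) ∈ locAt p (I : Set ℍ[F, c₁, c₂]) := by
    rw [hlam]
    exact ⟨1, fun h => hp'.not_isUnit (isUnit_of_dvd_one h), 1, O.one_mem, by simp⟩
  obtain ⟨n, hn, t, ht, hnt⟩ := exists_zsmul_eq_quatNrd_mul hp hlam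
    (hx _ (quatNrd_mem_normModule (A := A) (O := O) hmI))
  refine hp'.not_dvd_mul hn (hp'.not_dvd_mul hm hm) (hpD _ ((hD _).mpr ?_))
  convert ht using 1
  refine mul_left_cancel₀ (quatNrd_unit_ne_zero lam) ?_
  rw [← hnt, quatNrd_zsmul]
  simp only [zsmul_eq_mul]
  push_cast
  ring

end NormModule

theorem stabilizer_le_ker_squaring
    {F : Type*} [Field F] [NumberField F] {c₁ c₂ : F}
    (A : Subalgebra ℤ F) (hA : IsZOrder A)
    (O : Subalgebra ℤ ℍ[F, c₁, c₂]) (hO : IsProperOrder A O)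
    (a : (Submodule ↥A F)ˣ)
    (I : Submodule ℤ ℍ[F, c₁, c₂]) (hI : IsLocPrincRightIdeal O I)
    (hstab : ∃ lam : ℍ[F, c₁, c₂]ˣ, idMul A (a : Submodule ↥A F) I = lmul lam I) :
    ∃ x : F, x ≠ 0 ∧
      Submodule.span ↥(normOrder A O) (((a * a : (Submodule ↥A F)ˣ) : Submodule ↥A F) : Set F)
        = Submodule.span ↥(normOrder A O) {x} := by
  obtain ⟨lam, hlam⟩ := hstab
  have hn := quatNrd_unit_ne_zero lam
  have hAI : ∀ x ∈ A, ∀ y ∈ I, x • y ∈ I := fun x hx y hy => by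
    rw [Algebra.smul_def, Algebra.commutes]
    exact hI.2.2.1 y hy _ ((hO.2 x).mpr hx)
  refine ⟨quatNrd (lam : ℍ[F, c₁, c₂]), hn, le_antisymm (Submodule.span_le.mpr ?_) ?_⟩
  · intro w hw
    refine Submodule.mem_span_singleton.mpr
      ⟨⟨(quatNrd (lam : ℍ[F, c₁, c₂]))⁻¹ * w, mem_normOrder_of_forall_mul_mem hI ?_⟩, ?_⟩
    · intro z hz
      have := mul_mem_normModule_idMul (O := O) a I hw hz
      rw [hlam, mem_normModule_lmul_iff] at this
      obtain ⟨v, hv, hvz⟩ := this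
      rwa [mul_assoc, ← hvz, inv_mul_cancel_left₀ hn]
    · rw [Subalgebra.smul_def, smul_eq_mul]
      field_simp
  · rw [Submodule.span_singleton_le_iff_mem]
    have hmem : ∀ w ∈ (↑a⁻¹ : Submodule ↥A F) * (↑a⁻¹ : Submodule ↥A F),
        quatNrd (lam : ℍ[F, c₁, c₂]) * w ∈ normOrder A O := by
      refine fun w hw => mem_normOrder_of_forall_mul_mem hI fun z hz => ?_
      refine normModule_mono (idMul_inv_idMul_le a I hAI) ?_
      rw [mul_comm _ w, mul_assoc]
      refine mul_mem_normModule_idMul a⁻¹ _ hw ?_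
      rw [hlam, mem_normModule_lmul_iff]
      exact ⟨z, hz, rfl⟩
    have key : ∀ c ∈ ((a * a : (Submodule ↥A F)ˣ) : Submodule ↥A F) *
        ((↑a⁻¹ : Submodule ↥A F) * (↑a⁻¹ : Submodule ↥A F)),
        quatNrd (lam : ℍ[F, c₁, c₂]) * c ∈ Submodule.span ↥(normOrder A O)
          (((a * a : (Submodule ↥A F)ˣ) : Submodule ↥A F) : Set F) := by
      intro c hc
      induction hc using Submodule.mul_induction_on' with
      | mem_mul_mem v hv w hw =>
        rw [mul_left_comm, mul_comm v]
        exact Submodule.smul_mem _ (⟨_, hmem w hw⟩ : normOrder A O) (Submodule.subset_span hv)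
      | add x _ y _ hx hy => rw [mul_add]; exact add_mem hx hy
    have h1 : ((a * a : (Submodule ↥A F)ˣ) : Submodule ↥A F) *
        ((↑a⁻¹ : Submodule ↥A F) * (↑a⁻¹ : Submodule ↥A F)) = 1 := by
      rw [Units.val_mul, mul_mul_mul_comm, Units.mul_inv, mul_one]
    have := key 1 (by rw [h1]; exact Submodule.one_le.mp le_rfl)
    rwa [mul_one] at this

end
end

section
/- Let F be a number field, A a ℤ-order in F, and O a proper A-order in a quaternion F-algebra D. Suppose O is closed under the canonical involution of D and the class number h(A) is odd. Then the action of Pic(A) on Cl(O) given by [a]·[I] = [aI] is free. -/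
/-!
STATEMENT 6: Let `F` be a number field, `A` a `ℤ`-order in `F`, and `O` a proper `A`-order
in a quaternion `F`-algebra `D = ℍ[F,c₁,c₂]`.  Suppose `O` is closed under the canonical
involution (`star`) of `D` and the class number `h(A) = |Pic(A)|` is odd.  Then the action
of `Pic(A)` on `Cl(O)`, `[a]·[I] = [aI]`, is free.

Freeness is stated pointwise: whenever an invertible (= locally principal) fractional
`A`-ideal `a` fixes the class of a locally principal right `O`-ideal `I`
(i.e. `aI = λI` for some `λ ∈ Dˣ`), the class `[a]` is trivial, i.e. `a` is principal.
-/

noncomputable section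

open scoped Quaternion Pointwise

variable {F : Type*} [Field F] [NumberField F] {c₁ c₂ : F}

section ReducedNorm

variable {K : Type*} [Field K] {a b : K}

theorem quatNrd_mul_s6 (x y : ℍ[K, a, b]) : quatNrd (x * y) = quatNrd x * quatNrd y := by
  simp [quatNrd]
  ring

theorem quatNrd_one_s6 : quatNrd (1 : ℍ[K, a, b]) = 1 := by
  simp [quatNrd]

theorem mul_star_eq_algebraMap_quatNrd (x : ℍ[K, a, b]) :
    x * star x = algebraMap K ℍ[K, a, b] (quatNrd x) := by
  ext <;> simp [quatNrd, QuaternionAlgebra.algebraMap_eq] <;> ring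

theorem star_algebraMap_quaternionAlgebra (r : K) :
    star (algebraMap K ℍ[K, a, b] r) = algebraMap K ℍ[K, a, b] r := by
  ext <;> simp [QuaternionAlgebra.algebraMap_eq]

theorem quatNrd_inv_mul_quatNrd (u : ℍ[K, a, b]ˣ) :
    quatNrd (↑u⁻¹ : ℍ[K, a, b]) * quatNrd (u : ℍ[K, a, b]) = 1 := by
  rw [← quatNrd_mul_s6, Units.inv_mul, quatNrd_one_s6]

theorem quatNrd_conj_inv_mul_quatNrd (u v : ℍ[K, a, b]ˣ) :
    quatNrd (↑(v⁻¹ * u⁻¹ * v) : ℍ[K, a, b]) * quatNrd (u : ℍ[K, a, b]) = 1 := by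
  rw [Units.val_mul, Units.val_mul, quatNrd_mul_s6, quatNrd_mul_s6]
  linear_combination quatNrd (↑u⁻¹ : ℍ[K, a, b]) * quatNrd (u : ℍ[K, a, b]) *
    quatNrd_inv_mul_quatNrd v + quatNrd_inv_mul_quatNrd u

end ReducedNorm

theorem subset_locAt {V : Type*} [AddCommGroup V] {p : ℕ} (hp : p.Prime) (S : Set V) :
    S ⊆ locAt p S := fun x hx =>
  ⟨1, fun h => hp.one_lt.ne' (by exact_mod_cast Int.eq_one_of_dvd_one (by positivity) h),
    by simpa using hx⟩

/-- A `ℤ`-submodule is the intersection of its localizations at the rational primes. -/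
theorem mem_of_forall_mem_locAt {V : Type*} [AddCommGroup V] (M : Submodule ℤ V) {x : V}
    (h : ∀ p : ℕ, p.Prime → x ∈ locAt p (M : Set V)) : x ∈ M := by
  let J : Ideal ℤ := M.comap (LinearMap.toSpanSingleton ℤ V x)
  obtain ⟨d, hd⟩ := (IsPrincipalIdealRing.principal J).principal
  have hJ : ∀ n : ℤ, n • x ∈ M ↔ d ∣ n := fun n => by
    rw [← Ideal.mem_span_singleton, ← Ideal.submodule_span_eq, ← hd]
    simp [J]
  by_cases h1 : d.natAbs = 1
  · simpa using (hJ 1).2 (Int.natAbs_dvd.1 (by simp [h1]))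
  · obtain ⟨p, hp, hpd⟩ := Nat.exists_prime_and_dvd h1
    obtain ⟨n, hn, hx⟩ := h p hp
    exact absurd ((Int.natCast_dvd.2 hpd).trans ((hJ n).1 hx)) hn

section FractionalIdeals

variable {K : Type*} [Field K] {c d : K}
  {A : Subalgebra ℤ K} {O : Subalgebra ℤ ℍ[K, c, d]} {I : Submodule ℤ ℍ[K, c, d]}

theorem mem_lmul_iff {u : ℍ[K, c, d]ˣ} {x : ℍ[K, c, d]} :
    x ∈ lmul u I ↔ (↑u⁻¹ : ℍ[K, c, d]) * x ∈ I := by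
  constructor
  · rintro ⟨y, hy, rfl⟩
    simpa using hy
  · intro h
    exact ⟨_, h, by simp⟩

/-- If `aI ⊆ λI` then `a² ⊆ nrd(λ)A`: locally at every `p`, the ideal `a` multiplies a conjugate
`w` of `λ⁻¹` into `O`, so `f * g * nrd(w) = (f * w) * star (g * w)` lies in `O ∩ F = A` for all
`f` and `g` in `a`. -/
theorem mul_self_le_span_quatNrd [NumberField K]
    (hA : ∀ x : K, algebraMap K ℍ[K, c, d] x ∈ O → x ∈ A)
    (hstar : ∀ x ∈ O, star x ∈ O) (hI : IsLocPrincRightIdeal O I)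
    {a : Submodule A K} {u : ℍ[K, c, d]ˣ} (h : idMul A a I ≤ lmul u I) :
    a * a ≤ Submodule.span A {quatNrd (u : ℍ[K, c, d])} := by
  rw [Submodule.mul_le]
  intro f hf g hg
  let r : K := f * g * quatNrd (↑u⁻¹ : ℍ[K, c, d])
  suffices hr : r ∈ Subalgebra.toSubmodule A by
    refine Submodule.mem_span_singleton.2 ⟨⟨r, hr⟩, ?_⟩
    change r * quatNrd (u : ℍ[K, c, d]) = f * g
    linear_combination f * g * quatNrd_inv_mul_quatNrd u
  refine mem_of_forall_mem_locAt _ fun p hp => ?_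
  have hpZ : Prime (p : ℤ) := Nat.prime_iff_prime_int.1 hp
  obtain ⟨v, hv⟩ := hI.2.2.2 p hp
  obtain ⟨n, hn, hnv⟩ : (v : ℍ[K, c, d]) ∈ locAt p (I : Set ℍ[K, c, d]) := by
    rw [hv]
    exact subset_locAt hp _ ⟨1, O.one_mem, mul_one _⟩
  let w : ℍ[K, c, d]ˣ := v⁻¹ * u⁻¹ * v
  have key : ∀ e ∈ a, ∃ m : ℤ, ¬ (p : ℤ) ∣ m ∧ m • (algebraMap K ℍ[K, c, d] e * w) ∈ O := by
    intro e he
    have h1 : (↑u⁻¹ : ℍ[K, c, d]) * (algebraMap K ℍ[K, c, d] e * (n • (v : ℍ[K, c, d]))) ∈ I :=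
      mem_lmul_iff.1 (h (Submodule.subset_span ⟨e, he, _, hnv, rfl⟩))
    have h2 := subset_locAt hp (I : Set ℍ[K, c, d]) h1
    rw [hv] at h2
    obtain ⟨m, hm, y, hy, hym⟩ := h2
    refine ⟨m * n, hpZ.not_dvd_mul hm hn, ?_⟩
    have hcomm := Algebra.commutes e (↑v⁻¹ * ↑u⁻¹ : ℍ[K, c, d])
    have : (m * n) • (algebraMap K ℍ[K, c, d] e * w) = y := by
      have h3 : (↑v⁻¹ : ℍ[K, c, d]) * (v * y) = y := by simp
      rw [← h3]
      simp only at hym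
      rw [hym]
      simp only [w, Units.val_mul, ← mul_assoc, mul_smul_comm, mul_smul]
      rw [mul_assoc (algebraMap K ℍ[K, c, d] e), hcomm]
    rwa [this]
  obtain ⟨m, hm, hmO⟩ := key f hf
  obtain ⟨k, hk, hkO⟩ := key g hg
  refine ⟨m * k, hpZ.not_dvd_mul hm hk, hA _ ?_⟩
  have hw : quatNrd (w : ℍ[K, c, d]) = quatNrd (↑u⁻¹ : ℍ[K, c, d]) := by
    have hu := quatNrd_conj_inv_mul_quatNrd u v
    have hu' := quatNrd_inv_mul_quatNrd u
    exact mul_right_cancel₀ (right_ne_zero_of_mul_eq_one hu') (hu.trans hu'.symm)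
  have hprod := O.mul_mem hmO (hstar _ hkO)
  convert hprod using 1
  have hcomm := Algebra.commutes g ((w : ℍ[K, c, d]) * star (w : ℍ[K, c, d]))
  rw [star_zsmul, star_mul, star_algebraMap_quaternionAlgebra, smul_mul_smul_comm, map_zsmul]
  congr 1
  rw [mul_assoc, ← mul_assoc (w : ℍ[K, c, d]), ← hcomm, mul_star_eq_algebraMap_quatNrd, hw]
  simp only [r, map_mul, mul_assoc]

theorem idMul_inv_le_lmul_inv (hA : ∀ x ∈ A, algebraMap K ℍ[K, c, d] x ∈ O)
    (hI : ∀ x ∈ I, ∀ r ∈ O, x * r ∈ I) {a b : Submodule A K} (hba : b * a ≤ 1)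
    {u : ℍ[K, c, d]ˣ} (h : lmul u I ≤ idMul A a I) :
    idMul A b I ≤ lmul u⁻¹ I := by
  refine Submodule.span_le.2 ?_
  rintro _ ⟨g, hg, y, hy, rfl⟩
  have hmul : ∀ z ∈ idMul A a I, algebraMap K ℍ[K, c, d] g * z ∈ I := by
    intro z hz
    induction hz using Submodule.span_induction with
    | mem z hz =>
      obtain ⟨f, hf, x, hx, rfl⟩ := hz
      obtain ⟨s, hs⟩ := Submodule.mem_one.1 (hba (Submodule.mul_mem_mul hg hf))
      have hs' : (s : K) = g * f := hs
      rw [← mul_assoc, ← map_mul, ← hs', Algebra.commutes]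
      exact hI x hx _ (hA _ s.2)
    | zero => simp
    | add x y _ _ hx hy => rw [mul_add]; exact I.add_mem hx hy
    | smul n x _ hx => rw [mul_smul_comm]; exact I.smul_mem n hx
  rw [SetLike.mem_coe, mem_lmul_iff, inv_inv]
  have := hmul _ (h ⟨y, hy, rfl⟩)
  rwa [LinearMap.mulLeft_apply, ← mul_assoc, Algebra.commutes, mul_assoc] at this

end FractionalIdeals

theorem eq_one_of_sq_eq_one_of_odd_card {G : Type*} [Group G] (h : Odd (Nat.card G)) {g : G}
    (hg : g ^ 2 = 1) : g = 1 := by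
  obtain ⟨k, hk⟩ := h
  have : g ^ Nat.card G = 1 := pow_card_eq_one'
  rwa [hk, pow_succ, pow_mul, hg, one_pow, one_mul] at this

theorem action_free_of_star_stable_of_odd_class_number
    {F : Type*} [Field F] [NumberField F] {c₁ c₂ : F}
    (A : Subalgebra ℤ F) (hA : IsZOrder A)
    (O : Subalgebra ℤ ℍ[F, c₁, c₂]) (hO : IsProperOrder A O)
    (hstar : ∀ x ∈ O, star x ∈ O)
    (hodd : Odd (hPic A)) :
    ∀ a : (Submodule ↥A F)ˣ, ∀ I : Submodule ℤ ℍ[F, c₁, c₂], IsLocPrincRightIdeal O I →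
      (∃ lam : ℍ[F, c₁, c₂]ˣ, idMul A (a : Submodule ↥A F) I = lmul lam I) →
      ∃ x : F, x ≠ 0 ∧ (a : Submodule ↥A F) = Submodule.span ↥A {x} := by
  rintro a I hI ⟨lam, h⟩
  have hle := mul_self_le_span_quatNrd (fun x => (hO.2 x).1) hstar hI h.le
  have hle' := mul_self_le_span_quatNrd (fun x => (hO.2 x).1) hstar hI
    (idMul_inv_le_lmul_inv (fun x => (hO.2 x).2) hI.2.2.1 (Units.inv_mul a).le h.ge)
  have hN := quatNrd_inv_mul_quatNrd lam
  have hsq : (a : Submodule A F) * a = Submodule.span A {quatNrd (lam : ℍ[F, c₁, c₂])} := by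
    refine le_antisymm hle ?_
    have hinv : (↑a⁻¹ : Submodule A F) * ↑a⁻¹ * (a * a) = 1 := by
      rw [mul_mul_mul_comm, Units.inv_mul, one_mul]
    calc Submodule.span A {quatNrd (lam : ℍ[F, c₁, c₂])}
        = Submodule.span A {quatNrd (lam : ℍ[F, c₁, c₂])} *
            ((↑a⁻¹ : Submodule A F) * ↑a⁻¹ * (a * a)) := by rw [hinv, mul_one]
      _ ≤ Submodule.span A {quatNrd (lam : ℍ[F, c₁, c₂])} *
            (Submodule.span A {quatNrd (↑lam⁻¹ : ℍ[F, c₁, c₂])} * (a * a)) :=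
          mul_le_mul' le_rfl (mul_le_mul' hle' le_rfl)
      _ = (a : Submodule A F) * a := by
          rw [← mul_assoc, Submodule.span_mul_span, Set.singleton_mul_singleton,
            mul_comm (quatNrd _), hN, ← Submodule.one_eq_span, one_mul]
  have hcls : picCls A a = 1 := by
    refine eq_one_of_sq_eq_one_of_odd_card hodd ?_
    rw [pow_two]
    exact (QuotientGroup.eq_one_iff (a * a)).2
      ⟨_, (right_ne_zero_of_mul_eq_one hN).isUnit, by rw [Units.val_mul, hsq]⟩
  obtain ⟨x, hx, hax⟩ := (QuotientGroup.eq_one_iff a).1 hcls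
  exact ⟨x, hx.ne_zero, hax⟩

end
end
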